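/- Let M be a random N×N complex Hermitian matrix whose distribution is invariant under conjugation by every unitary matrix u ∈ U(N) and whose diagonal entries M_{11}, …, M_{NN} are independent standard real Gaussian N(0,1) random variables. Then M is a rank-N GUE random matrix: its law equals the law of the random Hermitian matrix whose entries are independent up to the Hermitian symmetry, with diagonal entries standard real Gaussians N(0,1) and with the real and imaginary parts of each above-diagonal entry independent real Gaussians N(0,1/2). -/

import Mathlib

open MeasureTheory ProbabilityTheory

/-- Matrices over a measurable space of entries, with the product σ-algebra. -/
noncomputable instance matrixMeasurableSpace {N : ℕ} :
    MeasurableSpace (Matrix (Fin N) (Fin N) ℂ) :=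
  show MeasurableSpace (Fin N → Fin N → ℂ) from inferInstance

/-- Indices of the strictly-above-diagonal entries of an `N×N` matrix. -/
abbrev AboveDiag (N : ℕ) := {p : Fin N × Fin N // p.1 < p.2}

/-- The source of randomness for a GUE matrix: independent standard Gaussians `N(0,1)` for the
diagonal, and independent Gaussians `N(0,1/2)` for the real and imaginary parts of the entries
above the diagonal. -/
noncomputable def gueBase (N : ℕ) :
    Measure ((Fin N → ℝ) × ((AboveDiag N → ℝ) × (AboveDiag N → ℝ))) :=
  (Measure.pi fun _ => gaussianReal 0 1).prod
    ((Measure.pi fun _ => gaussianReal 0 (1 / 2)).prod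
      (Measure.pi fun _ => gaussianReal 0 (1 / 2)))

/-- Assembling an `N×N` Hermitian matrix from the diagonal values and the real/imaginary parts
of the above-diagonal values. -/
noncomputable def gueMatrix (N : ℕ)
    (ω : (Fin N → ℝ) × ((AboveDiag N → ℝ) × (AboveDiag N → ℝ))) :
    Matrix (Fin N) (Fin N) ℂ :=
  Matrix.of fun i j =>
    if h : i < j then (ω.2.1 ⟨(i, j), h⟩ : ℂ) + (ω.2.2 ⟨(i, j), h⟩ : ℂ) * Complex.I
    else if h' : j < i then (ω.2.1 ⟨(j, i), h'⟩ : ℂ) - (ω.2.2 ⟨(j, i), h'⟩ : ℂ) * Complex.I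
    else ((ω.1 i : ℝ) : ℂ)

/-- The law of a rank-`N` GUE random matrix: entries independent up to Hermitian symmetry,
diagonal entries `N(0,1)`, real and imaginary parts of above-diagonal entries `N(0,1/2)`. -/
noncomputable def gueMeasure (N : ℕ) : Measure (Matrix (Fin N) (Fin N) ℂ) :=
  Measure.map (gueMatrix N) (gueBase N)

open Complex in
/-- The characteristic function of a product of centred Gaussians of common variance. -/
lemma charFunDual_pi_gaussianReal_zero {ι : Type*} [Fintype ι] [DecidableEq ι] (v : NNReal)
    (L : StrongDual ℝ (ι → ℝ)) :
    charFunDual (Measure.pi fun _ : ι => gaussianReal 0 v) L =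
      exp (-((v * ∑ i, L (Pi.single i 1) ^ 2 : ℝ) : ℂ) / 2) := by
  have hone (l : StrongDual ℝ ℝ) :
      charFunDual (gaussianReal 0 v) l = exp (-((v * l 1 ^ 2 : ℝ) : ℂ) / 2) := by
    have hl (x : ℝ) : l x = l 1 * x := by
      simpa [mul_comm] using l.map_smul x 1
    calc charFunDual (gaussianReal 0 v) l = charFun (gaussianReal 0 v) (l 1) := by
          rw [charFunDual_apply, charFun_apply_real]
          refine integral_congr_ae (.of_forall fun x => ?_)
          change exp (l x * I) = _
          rw [hl x, ofReal_mul]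
      _ = _ := by
          rw [charFun_gaussianReal]
          push_cast
          ring_nf
  rw [charFunDual_pi]
  simp_rw [hone]
  rw [← exp_sum, Finset.mul_sum, ofReal_sum, ← Finset.sum_div, Finset.sum_neg_distrib]
  simp

/-- A double sum splits into its diagonal part and the pairs of mutually transposed terms. -/
lemma sum_sum_eq_sum_diag_add_sum_aboveDiag {N : ℕ} {R : Type*} [AddCommMonoid R]
    (f : Fin N → Fin N → R) :
    ∑ i, ∑ j, f i j =
      ∑ i, f i i + ∑ p : AboveDiag N, (f p.1.1 p.1.2 + f p.1.2 p.1.1) := by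
  have hsub (g : Fin N → Fin N → R) :
      ∑ p : AboveDiag N, g p.1.1 p.1.2 = ∑ i, ∑ j, if i < j then g i j else 0 := by
    rw [← Fintype.sum_prod_type' (f := fun i j => if i < j then g i j else 0),
      ← Finset.sum_filter]
    exact (Finset.sum_subtype _ (by simp) fun p : Fin N × Fin N => g p.1 p.2).symm
  rw [Finset.sum_add_distrib, hsub f, hsub fun i j => f j i,
    Finset.sum_comm (f := fun i j => if i < j then f j i else 0), ← Finset.sum_add_distrib,
    ← Finset.sum_add_distrib]
  refine Finset.sum_congr rfl fun i _ => ?_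
  have hdiag : f i i = ∑ j, if i = j then f i j else 0 := by simp
  conv_rhs => rw [hdiag]
  rw [← Finset.sum_add_distrib, ← Finset.sum_add_distrib]
  refine Finset.sum_congr rfl fun j _ => ?_
  rcases lt_trichotomy i j with h | h | h
  · simp [h, h.ne, h.not_gt]
  · simp [h]
  · simp [h, h.ne', h.not_gt]

/-- The diagonal entries and the real and imaginary parts of the above-diagonal entries. -/
noncomputable def hermitianCoords {N : ℕ} (A : Matrix (Fin N) (Fin N) ℂ) :
    (Fin N → ℝ) × ((AboveDiag N → ℝ) × (AboveDiag N → ℝ)) :=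
  (fun i => (A i i).re, fun p => (A p.1.1 p.1.2).re, fun p => (A p.1.1 p.1.2).im)

lemma measurable_matrix_apply {N : ℕ} (i j : Fin N) :
    Measurable fun A : Matrix (Fin N) (Fin N) ℂ => A i j :=
  (measurable_pi_apply j).comp (measurable_pi_apply (X := fun _ : Fin N => Fin N → ℂ) i)

lemma measurable_matrix_of_apply {α : Type*} [MeasurableSpace α] {N : ℕ}
    {F : α → Matrix (Fin N) (Fin N) ℂ} (h : ∀ i j, Measurable fun a => F a i j) :
    Measurable F :=
  measurable_pi_lambda (X := fun _ : Fin N => Fin N → ℂ) F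
    fun i => measurable_pi_lambda _ fun j => h i j

lemma measurable_hermitianCoords {N : ℕ} :
    Measurable (hermitianCoords : Matrix (Fin N) (Fin N) ℂ → _) := by
  have h := measurable_matrix_apply (N := N)
  unfold hermitianCoords
  fun_prop

lemma measurable_gueMatrix (N : ℕ) : Measurable (gueMatrix N) := by
  refine measurable_matrix_of_apply fun i j => ?_
  unfold gueMatrix
  simp only [Matrix.of_apply]
  split_ifs <;> fun_prop

lemma gueMatrix_hermitianCoords {N : ℕ} {A : Matrix (Fin N) (Fin N) ℂ} (hA : A.IsHermitian) :
    gueMatrix N (hermitianCoords A) = A := by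
  ext i j
  have hji := hA.apply i j
  simp only [gueMatrix, hermitianCoords, Matrix.of_apply]
  split_ifs with h h'
  · exact Complex.re_add_im _
  · rw [← hji]
    apply Complex.ext <;> simp
  · obtain rfl : i = j := le_antisymm (not_lt.1 h') (not_lt.1 h)
    exact Complex.conj_eq_iff_re.1 hji

lemma isHermitian_gueMatrix {N : ℕ} (ω : (Fin N → ℝ) × ((AboveDiag N → ℝ) × (AboveDiag N → ℝ))) :
    (gueMatrix N ω).IsHermitian := by
  ext i j
  rcases lt_trichotomy i j with h | rfl | h
  · simp [gueMatrix, h, h.not_gt, sub_eq_add_neg]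
  · simp [gueMatrix]
  · simp [gueMatrix, h, h.not_gt, sub_eq_add_neg]

/-- The trace form in the coordinates of Hermitian matrices. -/
lemma trace_gueMatrix_mul_gueMatrix {N : ℕ}
    (ω η : (Fin N → ℝ) × ((AboveDiag N → ℝ) × (AboveDiag N → ℝ))) :
    (gueMatrix N ω * gueMatrix N η).trace =
      ((∑ i, ω.1 i * η.1 i + (2 * ∑ p, ω.2.1 p * η.2.1 p + 2 * ∑ p, ω.2.2 p * η.2.2 p) : ℝ) :
        ℂ) := by
  simp only [Matrix.trace, Matrix.diag, Matrix.mul_apply]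
  rw [sum_sum_eq_sum_diag_add_sum_aboveDiag, Finset.mul_sum, Finset.mul_sum,
    ← Finset.sum_add_distrib, Complex.ofReal_add, Complex.ofReal_sum, Complex.ofReal_sum]
  congr 1
  · simp [gueMatrix]
  · refine Finset.sum_congr rfl fun p _ => ?_
    simp only [gueMatrix, Matrix.of_apply, p.2, p.2.not_gt, dite_true, dite_false]
    apply Complex.ext <;> simp <;> ring

open Complex in
/-- The characteristic function of a unitarily invariant random Hermitian matrix with independent
standard Gaussian diagonal entries. -/
lemma integral_exp_trace_mul_of_invariant
    {Ω : Type*} [MeasurableSpace Ω] (P : Measure Ω) [IsProbabilityMeasure P]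
    {N : ℕ} (M : Ω → Matrix (Fin N) (Fin N) ℂ) (hMmeas : Measurable M)
    (hinv : ∀ u : Matrix.unitaryGroup (Fin N) ℂ,
      Measure.map (fun ω => (u : Matrix (Fin N) (Fin N) ℂ) * M ω *
        (star (u : Matrix (Fin N) (Fin N) ℂ))) P = Measure.map M P)
    (hdiag : Measure.map (fun ω (i : Fin N) => (M ω i i).re) P =
      Measure.pi (fun _ : Fin N => gaussianReal 0 1))
    {H : Matrix (Fin N) (Fin N) ℂ} (hH : H.IsHermitian) :
    ∫ ω, exp ((H * M ω).trace.re * I) ∂P = exp (-(H * H).trace / 2) := by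
  have hentry (i j : Fin N) : Measurable fun ω => M ω i j :=
    (measurable_matrix_apply i j).comp hMmeas
  set U := hH.eigenvectorUnitary
  set d := hH.eigenvalues
  have hspec : H = (U : Matrix (Fin N) (Fin N) ℂ) * Matrix.diagonal (fun i => (d i : ℂ)) *
      star (U : Matrix (Fin N) (Fin N) ℂ) := hH.spectral_theorem
  have htrace (A : Matrix (Fin N) (Fin N) ℂ) : (H * A).trace.re =
      ∑ i, d i * ((star (U : Matrix (Fin N) (Fin N) ℂ) * A * U) i i).re := by
    have : (H * A).trace = (Matrix.diagonal (fun i => (d i : ℂ)) *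
        (star (U : Matrix (Fin N) (Fin N) ℂ) * A * U)).trace := by
      rw [hspec, mul_assoc, mul_assoc, Matrix.trace_mul_comm]
      simp only [mul_assoc]
    rw [this]
    simp [Matrix.trace, Matrix.diagonal_mul]
  have hsq : (H * H).trace = ((∑ i, d i ^ 2 : ℝ) : ℂ) := by
    have hUU : star (U : Matrix (Fin N) (Fin N) ℂ) * U = 1 := Unitary.coe_star_mul_self U
    have : (H * H).trace = (Matrix.diagonal (fun i => (d i : ℂ)) *
        Matrix.diagonal (fun i => (d i : ℂ))).trace := by
      have hmul : H * H = (U : Matrix (Fin N) (Fin N) ℂ) * (Matrix.diagonal (fun i => (d i : ℂ)) *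
          (star (U : Matrix (Fin N) (Fin N) ℂ) * U) * Matrix.diagonal (fun i => (d i : ℂ))) *
          star (U : Matrix (Fin N) (Fin N) ℂ) := by
        conv_lhs => rw [hspec]
        simp only [mul_assoc]
      rw [hmul, hUU, mul_one, mul_assoc, Matrix.trace_mul_comm, mul_assoc, hUU, mul_one]
    rw [this]
    simp [Matrix.trace, sq]
  let g : Matrix (Fin N) (Fin N) ℂ → ℂ := fun A => exp ((∑ i, d i * (A i i).re : ℝ) * I)
  have hg : Measurable g := by
    have h := measurable_matrix_apply (N := N)
    fun_prop
  have hconj : Measurable fun ω => star (U : Matrix (Fin N) (Fin N) ℂ) * M ω *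
      (U : Matrix (Fin N) (Fin N) ℂ) := by
    refine measurable_matrix_of_apply fun i j => ?_
    simp only [Matrix.mul_apply]
    fun_prop
  have hmap : Measure.map (fun ω => star (U : Matrix (Fin N) (Fin N) ℂ) * M ω *
      (U : Matrix (Fin N) (Fin N) ℂ)) P = Measure.map M P := by
    simpa using hinv (star U)
  let L : StrongDual ℝ (Fin N → ℝ) := ∑ i, d i • ContinuousLinearMap.proj i
  have hL (x : Fin N → ℝ) : L x = ∑ i, d i * x i := by simp [L]
  calc ∫ ω, exp ((H * M ω).trace.re * I) ∂P
      = ∫ ω, g (star (U : Matrix (Fin N) (Fin N) ℂ) * M ω * U) ∂P := by simp only [htrace, g]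
    _ = ∫ ω, g (M ω) ∂P := by
        rw [← integral_map hconj.aemeasurable hg.aestronglyMeasurable, hmap,
          integral_map hMmeas.aemeasurable hg.aestronglyMeasurable]
    _ = charFunDual (Measure.map (fun ω (i : Fin N) => (M ω i i).re) P) L := by
        rw [charFunDual_apply, integral_map (by fun_prop) (by fun_prop)]
        simp only [g, hL]
    _ = exp (-(H * H).trace / 2) := by
        rw [hdiag, charFunDual_pi_gaussianReal_zero, hsq]
        simp [hL, Pi.single_apply]

lemma map_hermitianCoords_eq_gueBase
    {Ω : Type*} [MeasurableSpace Ω] (P : Measure Ω) [IsProbabilityMeasure P]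
    {N : ℕ} (M : Ω → Matrix (Fin N) (Fin N) ℂ) (hMmeas : Measurable M)
    (hHerm : ∀ ω, (M ω).IsHermitian)
    (hinv : ∀ u : Matrix.unitaryGroup (Fin N) ℂ,
      Measure.map (fun ω => (u : Matrix (Fin N) (Fin N) ℂ) * M ω *
        (star (u : Matrix (Fin N) (Fin N) ℂ))) P = Measure.map M P)
    (hdiag : Measure.map (fun ω (i : Fin N) => (M ω i i).re) P =
      Measure.pi (fun _ : Fin N => gaussianReal 0 1)) :
    Measure.map (fun ω => hermitianCoords (M ω)) P = gueBase N := by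
  have hmeas : Measurable fun ω => hermitianCoords (M ω) := measurable_hermitianCoords.comp hMmeas
  have : IsFiniteMeasure (gueBase N) := by unfold gueBase; infer_instance
  refine Measure.ext_of_charFunDual (funext fun L => ?_)
  let a : Fin N → ℝ := fun i => L (Pi.single i 1, 0, 0)
  let b : AboveDiag N → ℝ := fun p => L (0, Pi.single p 1, 0)
  let c : AboveDiag N → ℝ := fun p => L (0, 0, Pi.single p 1)
  let η : (Fin N → ℝ) × ((AboveDiag N → ℝ) × (AboveDiag N → ℝ)) :=
    (a, fun p => b p / 2, fun p => c p / 2)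
  have hpi {ι : Type} [Fintype ι] [DecidableEq ι] (l : StrongDual ℝ (ι → ℝ)) (x : ι → ℝ) :
      l x = ∑ i, l (Pi.single i 1) * x i := by
    conv_lhs => rw [pi_eq_sum_univ' x, map_sum]
    simp [mul_comm, Pi.single]
  have hL (x : (Fin N → ℝ) × ((AboveDiag N → ℝ) × (AboveDiag N → ℝ))) :
      L x = (∑ i, a i * x.1 i) + (∑ p, b p * x.2.1 p + ∑ p, c p * x.2.2 p) := by
    have h1 := hpi (L.comp (.inl ℝ _ _)) x.1
    have h2 := hpi (L.comp ((ContinuousLinearMap.inr ℝ _ _).comp (.inl ℝ _ _))) x.2.1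
    have h3 := hpi (L.comp ((ContinuousLinearMap.inr ℝ _ _).comp (.inr ℝ _ _))) x.2.2
    simp only [ContinuousLinearMap.comp_apply, ContinuousLinearMap.inl_apply,
      ContinuousLinearMap.inr_apply] at h1 h2 h3
    have hx : L x = L (x.1, 0) + (L (0, x.2.1, 0) + L (0, 0, x.2.2)) := by
      rw [← map_add, ← map_add]
      simp
    rw [hx, h1, h2, h3]
    rfl
  have htr (ω : Ω) : L (hermitianCoords (M ω)) = (gueMatrix N η * M ω).trace.re := by
    conv_rhs => rw [← gueMatrix_hermitianCoords (hHerm ω), trace_gueMatrix_mul_gueMatrix]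
    rw [hL, Complex.ofReal_re, Finset.mul_sum, Finset.mul_sum]
    simp only [η]
    ring_nf
  rw [charFunDual_apply, integral_map hmeas.aemeasurable (by fun_prop)]
  simp_rw [htr]
  rw [integral_exp_trace_mul_of_invariant P M hMmeas hinv hdiag (isHermitian_gueMatrix η),
    trace_gueMatrix_mul_gueMatrix, gueBase, charFunDual_prod, charFunDual_prod,
    charFunDual_pi_gaussianReal_zero, charFunDual_pi_gaussianReal_zero,
    charFunDual_pi_gaussianReal_zero, ← Complex.exp_add, ← Complex.exp_add]
  congr 1
  change _ = -(((1 : NNReal) * ∑ i, a i ^ 2 : ℝ) : ℂ) / 2 +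
    (-((((1 / 2 : NNReal) : ℝ) * ∑ p, b p ^ 2 : ℝ) : ℂ) / 2 +
      -((((1 / 2 : NNReal) : ℝ) * ∑ p, c p ^ 2 : ℝ) : ℂ) / 2)
  have hhalf {ι : Type} [Fintype ι] (f : ι → ℝ) :
      ∑ p, (f p / 2) ^ 2 = (∑ p, f p ^ 2) / 4 := by
    rw [Finset.sum_div]
    exact Finset.sum_congr rfl fun p _ => by ring
  simp only [η, ← sq, hhalf]
  push_cast
  ring

/-- If a random Hermitian `N×N` matrix `M` has unitarily invariant law and independent standard
Gaussian `N(0,1)` diagonal entries, then `M` is a rank-`N` GUE matrix: its law is `gueMeasure N`. -/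
theorem invariant_gaussian_diagonal_is_GUE
    {Ω : Type*} [MeasurableSpace Ω] (P : Measure Ω) [IsProbabilityMeasure P]
    (N : ℕ) (M : Ω → Matrix (Fin N) (Fin N) ℂ) (hMmeas : Measurable M)
    (hHerm : ∀ ω, (M ω).IsHermitian)
    (hinv : ∀ u : Matrix.unitaryGroup (Fin N) ℂ,
      Measure.map (fun ω => (u : Matrix (Fin N) (Fin N) ℂ) * M ω *
        (star (u : Matrix (Fin N) (Fin N) ℂ))) P = Measure.map M P)
    (hdiag : Measure.map (fun ω (i : Fin N) => (M ω i i).re) P =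
      Measure.pi (fun _ : Fin N => gaussianReal 0 1)) :
    Measure.map M P = gueMeasure N := by
  have hmeas : Measurable fun ω => hermitianCoords (M ω) := measurable_hermitianCoords.comp hMmeas
  rw [gueMeasure, ← map_hermitianCoords_eq_gueBase P M hMmeas hHerm hinv hdiag,
    Measure.map_map (measurable_gueMatrix N) hmeas]
  congr 1
  funext ω
  exact (gueMatrix_hermitianCoords (hHerm ω)).symm
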